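/- Let α>0 with α≠1, s<0, t>0. Then for every point x ∈ A_{α,s,t} there exist a neighborhood U of x in A_{α,s,t} and a constant M>0 such that every harmonic map f: Δ → A_{α,s,t} with f(0) ∈ U satisfies ‖df(0)‖ < M. (By the tube-domain hyperbolicity criterion, this is equivalent to the Kobayashi hyperbolicity of the tube domain T_{A_{α,s,t}}.) -/

import Mathlib

open Complex Metric Set Filter Topology

/-- The base domain `A_{α,s,t}`: `x₂ > t·x₁^α` for `x₁ > 0`, `x₂ > 0` for `x₁ = 0`,
and `x₂ > s·(-x₁)^α` for `x₁ < 0`. -/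
def setA (α s t : ℝ) : Set (ℝ × ℝ) :=
  {x | (0 < x.1 → t * x.1 ^ α < x.2) ∧ (x.1 = 0 → 0 < x.2) ∧
       (x.1 < 0 → s * (-x.1) ^ α < x.2)}

/-- The Laplacian of `u : ℂ → ℝ`, as the sum of the second directional derivatives
in the directions `1` and `I`. -/
noncomputable def laplacian (u : ℂ → ℝ) (z : ℂ) : ℝ :=
  fderiv ℝ (fun w => fderiv ℝ u w 1) z 1 +
    fderiv ℝ (fun w => fderiv ℝ u w Complex.I) z Complex.I

/-- A real-valued function is harmonic on a set if it is `C²` there and its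
Laplacian vanishes there. -/
def HarmonicOn (u : ℂ → ℝ) (s : Set ℂ) : Prop :=
  ContDiffOn ℝ 2 u s ∧ ∀ z ∈ s, laplacian u z = 0

/-- A map `f = (u, v) : ℂ → ℝ²` is a harmonic map on a set if both components
are harmonic there. -/
def HarmonicMapOn (f : ℂ → ℝ × ℝ) (s : Set ℂ) : Prop :=
  HarmonicOn (fun z => (f z).1) s ∧ HarmonicOn (fun z => (f z).2) s


/-- Maximum principle for continuous functions supported from below by moduli of holomorphic
functions. -/
lemma max_principle_support (Φ : ℂ → ℝ) (r C : ℝ) (hr : 0 < r)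
    (hc : ContinuousOn Φ (closedBall (0 : ℂ) r))
    (hs : ∀ z₀ ∈ ball (0 : ℂ) r, ∃ H : ℂ → ℂ, (∀ᶠ z in 𝓝 z₀, DifferentiableAt ℂ H z) ∧
      (∀ᶠ z in 𝓝 z₀, ‖H z‖ ≤ Φ z) ∧ ‖H z₀‖ = Φ z₀)
    (hb : ∀ z : ℂ, ‖z‖ = r → Φ z ≤ C) : Φ 0 ≤ C := by
  have hK : IsCompact (closedBall (0 : ℂ) r) := isCompact_closedBall 0 r
  obtain ⟨z₁, hz₁, hmax⟩ := hK.exists_isMaxOn ⟨0, by simp [hr.le]⟩ hc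
  have hS : IsCompact (closedBall (0 : ℂ) r ∩ Φ ⁻¹' {Φ z₁}) :=
    hK.of_isClosed_subset (hc.preimage_isClosed_of_isClosed isClosed_closedBall
      isClosed_singleton) inter_subset_left
  obtain ⟨z₀, ⟨hz₀, hz₀M⟩, hz₀max⟩ := hS.exists_isMaxOn ⟨z₁, hz₁, rfl⟩ continuous_norm.continuousOn
  have hz₀M : Φ z₀ = Φ z₁ := hz₀M
  have h0 : Φ 0 ≤ Φ z₁ := hmax (by simp [hr.le])
  have hle : ‖z₀‖ ≤ r := by simpa using hz₀
  rcases hle.eq_or_lt with h | h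
  · linarith [hb z₀ h]
  exfalso
  have hball : z₀ ∈ ball (0 : ℂ) r := by simpa using h
  have hnb : ∀ᶠ z in 𝓝 z₀, z ∈ closedBall (0 : ℂ) r :=
    mem_of_superset (isOpen_ball.mem_nhds hball) ball_subset_closedBall
  obtain ⟨H, hd, hH, hH0⟩ := hs z₀ hball
  have hloc : IsLocalMax (norm ∘ H) z₀ := by
    filter_upwards [hH, hnb] with z h1 h2
    have : Φ z ≤ Φ z₁ := hmax h2
    simp only [Function.comp]
    linarith
  have hev := Complex.norm_eventually_eq_of_isLocalMax hd hloc
  have hloc2 : IsLocalMax (norm ∘ (fun z : ℂ => z)) z₀ := by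
    filter_upwards [hH, hnb, hev] with z h1 h2 h3
    have h4 : Φ z ≤ Φ z₁ := hmax h2
    exact hz₀max ⟨h2, show Φ z = Φ z₁ by linarith⟩
  have h5 := Complex.eventually_eq_of_isLocalMax_norm (Eventually.of_forall fun z =>
    differentiableAt_id) hloc2
  have h6 : ({z₀} : Set ℂ) ∈ 𝓝 z₀ := h5
  have h7 : IsOpen ({z₀} : Set ℂ) := by
    rw [isOpen_iff_mem_nhds]; rintro _ rfl; exact h6
  exact not_isOpen_singleton z₀ h7

lemma bump_ge_one (y : ℝ) (h1 : 3 / 4 ≤ y) (h2 : y ≤ 1) : 1 ≤ y * Real.exp (1 - y ^ 2) := by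
  have hy : 0 < y := by linarith
  have h3 := Real.one_sub_inv_le_log_of_pos (x := y ^ 2) (by positivity)
  rw [Real.log_pow] at h3
  have h4 : 0 ≤ Real.log y + (1 - y ^ 2) := by
    have : 0 ≤ (1 - (y ^ 2)⁻¹) / 2 + (1 - y ^ 2) := by
      have h5 : (1 - (y ^ 2)⁻¹) / 2 + (1 - y ^ 2) = (1 - y ^ 2) * (2 * y ^ 2 - 1) / (2 * y ^ 2) := by
        field_simp
        ring
      rw [h5]
      apply div_nonneg (mul_nonneg _ _) (by positivity) <;> nlinarith
    push_cast at h3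
    linarith
  calc (1 : ℝ) ≤ Real.exp (Real.log y + (1 - y ^ 2)) := Real.one_le_exp h4
    _ = y * Real.exp (1 - y ^ 2) := by rw [Real.exp_add, Real.exp_log hy]

lemma core_bound (W : ℂ → ℂ) (κ : ℂ → ℝ) (δ B : ℝ) (hδ : 0 < δ)
    (hW : DifferentiableOn ℂ W (ball 0 1)) (hκ : ContinuousOn κ (ball 0 1))
    (h0 : ∀ z ∈ ball (0 : ℂ) 1, κ z = 0 → (W z).re < 0)
    (hB : ∀ z ∈ ball (0 : ℂ) 1, 0 < κ z → (W z).re ≤ B)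
    (hκ0 : 0 < κ 0) (hW0 : δ < (W 0).re) :
    ‖deriv W 0‖ ≤ 2 * δ * Real.exp (1 + 2 / δ ^ 2 * B ^ 2) := by
  classical
  have hopen : ∀ z ∈ ball (0 : ℂ) 1, ball (0 : ℂ) 1 ∈ 𝓝 z := fun z hz => isOpen_ball.mem_nhds hz
  have h0b : (0 : ℂ) ∈ ball (0 : ℂ) 1 := by simp
  have hWc : ∀ z ∈ ball (0 : ℂ) 1, ContinuousAt W z := fun z hz =>
    (hW.differentiableAt (hopen z hz)).continuousAt
  have hwc : ∀ z ∈ ball (0 : ℂ) 1, ContinuousAt (fun z => (W z).re) z := fun z hz =>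
    Complex.continuous_re.continuousAt.comp (hWc z hz)
  have hκc : ∀ z ∈ ball (0 : ℂ) 1, ContinuousAt κ z := fun z hz => hκ.continuousAt (hopen z hz)
  have hζc : ∀ z ∈ ball (0 : ℂ) 1, ContinuousAt (fun z => ‖W z - W 0‖) z := fun z hz =>
    ((hWc z hz).sub continuousAt_const).norm
  set w₀ := (W 0).re with hw₀
  set Hin : ℂ → ℂ := fun z => dslope W 0 z *
    Complex.exp (1 + (2 / δ ^ 2 : ℝ) * ((w₀ : ℂ) ^ 2 + 2 * w₀ * (W z - W 0) + (W z - W 0) ^ 2 / 2))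
      / δ with hHin
  have hHd : DifferentiableOn ℂ Hin (ball 0 1) := by
    have hds : DifferentiableOn ℂ (dslope W 0) (ball 0 1) :=
      (Complex.differentiableOn_dslope (hopen 0 h0b)).2 hW
    have : DifferentiableOn ℂ (fun z => W z - W 0) (ball 0 1) := hW.sub_const _
    rw [hHin]
    fun_prop
  -- key identity
  have hkey : ∀ z, z ≠ 0 → ‖Hin z‖ = 1 / ‖z‖ * Real.exp (2 / δ ^ 2 * (W z).re ^ 2) *
      (‖W z - W 0‖ / δ * Real.exp (1 - (‖W z - W 0‖ / δ) ^ 2)) := by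
    intro z hz
    simp only [hHin, norm_div, norm_mul, Complex.norm_exp, Complex.norm_real]
    rw [dslope_of_ne _ hz, slope_def_field, norm_div, sub_zero, Real.norm_of_nonneg hδ.le]
    have : Real.exp ((1 + ((2 / δ ^ 2 : ℝ) : ℂ) *
        ((w₀ : ℂ) ^ 2 + 2 * w₀ * (W z - W 0) + (W z - W 0) ^ 2 / 2)).re) =
        Real.exp (2 / δ ^ 2 * (W z).re ^ 2) * Real.exp (1 - (‖W z - W 0‖ / δ) ^ 2) := by
      rw [← Real.exp_add]
      congr 1
      have hn : ‖W z - W 0‖ ^ 2 = ((W z).re - w₀) ^ 2 + ((W z).im - (W 0).im) ^ 2 := by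
        rw [Complex.sq_norm, Complex.normSq_apply]; simp [hw₀]; ring
      rw [div_pow, hn]
      rw [Complex.add_re, Complex.re_ofReal_mul]
      have : ((w₀ : ℂ) ^ 2 + 2 * w₀ * (W z - W 0) + (W z - W 0) ^ 2 / 2).re =
          w₀ ^ 2 + 2 * w₀ * ((W z).re - w₀) +
            (((W z).re - w₀) ^ 2 - ((W z).im - (W 0).im) ^ 2) / 2 := by
        simp [pow_two, hw₀, Complex.mul_re]
      rw [this, Complex.one_re]
      field_simp
      ring
    rw [this]
    ring
  have hre : ∀ z, w₀ - (W z).re ≤ ‖W z - W 0‖ := by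
    intro z
    have := Complex.abs_re_le_norm (W z - W 0)
    have h2 := neg_le_abs (W z - W 0).re
    simp only [Complex.sub_re] at *
    linarith
  set Φ : ℂ → ℝ := fun z => if 0 < κ z ∧ ‖W z - W 0‖ < δ then ‖Hin z‖ else
    1 / ‖z‖ * Real.exp (2 / δ ^ 2 * (if 0 < κ z then max (W z).re 0 else 0) ^ 2) with hΦ
  -- local descriptions
  have hA : ∀ z ∈ ball (0 : ℂ) 1, 0 < κ z → ‖W z - W 0‖ < δ → Φ =ᶠ[𝓝 z] fun z => ‖Hin z‖ := by
    intro z hz h1 h2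
    filter_upwards [(hκc z hz).eventually_const_lt h1, (hζc z hz).eventually_lt_const h2]
      with y hy1 hy2
    simp only [hΦ]
    rw [if_pos ⟨hy1, hy2⟩]
  have hne : ∀ z, ¬ (0 < κ z ∧ ‖W z - W 0‖ < δ) → z ≠ 0 := by
    rintro z h rfl
    exact h ⟨hκ0, by simpa using hδ⟩
  have hBl : ∀ z ∈ ball (0 : ℂ) 1, 0 < κ z → δ ≤ ‖W z - W 0‖ → Φ =ᶠ[𝓝 z] fun z =>
      1 / ‖z‖ * Real.exp (2 / δ ^ 2 * (max (W z).re 0) ^ 2) *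
        (min (‖W z - W 0‖ / δ) 1 * Real.exp (1 - (min (‖W z - W 0‖ / δ) 1) ^ 2)) := by
    intro z hz h1 h2
    filter_upwards [(hκc z hz).eventually_const_lt h1,
      isOpen_ne.mem_nhds (hne z fun h => absurd h.2 (not_lt.2 h2))] with y hy1 hy2
    simp only [hΦ]
    by_cases h3 : ‖W y - W 0‖ < δ
    · rw [if_pos ⟨hy1, h3⟩, hkey y hy2, max_eq_left (by linarith [hre y]),
        min_eq_left ((div_le_one hδ).2 h3.le)]
    · rw [if_neg (fun h => h3 h.2), if_pos hy1, min_eq_right ((one_le_div hδ).2 (not_lt.1 h3))]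
      simp
  have hC : ∀ z ∈ ball (0 : ℂ) 1, κ z ≤ 0 → Φ =ᶠ[𝓝 z] fun z => 1 / ‖z‖ := by
    intro z hz h1
    have : ∀ᶠ y in 𝓝 z, κ y < 0 ∨ (W y).re < 0 := by
      rcases h1.lt_or_eq with h | h
      · filter_upwards [(hκc z hz).eventually_lt_const h] with y hy using Or.inl hy
      · filter_upwards [(hwc z hz).eventually_lt_const (h0 z hz h)] with y hy using Or.inr hy
    filter_upwards [this] with y hy
    simp only [hΦ]
    rcases hy with hy | hy
    · rw [if_neg (fun h => absurd h.1 (not_lt.2 hy.le)), if_neg (not_lt.2 hy.le)]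
      simp
    · rw [if_neg (fun h => absurd h.2 (by linarith [hre y])), max_eq_right hy.le]
      simp
  have hsub : closedBall (0 : ℂ) (1 / 2) ⊆ ball 0 1 := closedBall_subset_ball (by norm_num)
  have hcont : ContinuousOn Φ (closedBall (0 : ℂ) (1 / 2)) := by
    intro z hz'
    have hz := hsub hz'
    apply ContinuousAt.continuousWithinAt
    by_cases h1 : 0 < κ z
    · by_cases h2 : ‖W z - W 0‖ < δ
      · exact ((hHd.differentiableAt (hopen z hz)).continuousAt.norm).congr (hA z hz h1 h2).symm
      · refine ContinuousAt.congr ?_ (hBl z hz h1 (not_lt.1 h2)).symm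
        have hz0 : ‖z‖ ≠ 0 := norm_ne_zero_iff.2 (hne z fun h => h2 h.2)
        have e1 := hwc z hz
        have e2 := hζc z hz
        have e3 : ContinuousAt (fun z => max (W z).re 0) z := e1.max continuousAt_const
        have e4 : ContinuousAt (fun z => min (‖W z - W 0‖ / δ) 1) z :=
          (e2.div_const δ).min continuousAt_const
        have e5 : ContinuousAt (fun z : ℂ => 1 / ‖z‖) z :=
          continuousAt_const.div continuous_norm.continuousAt hz0
        exact (e5.mul (Real.continuous_exp.continuousAt.comp
          ((e3.pow 2).const_mul (2 / δ ^ 2)))).mul (e4.mul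
            (Real.continuous_exp.continuousAt.comp ((e4.pow 2).const_sub 1)))
    · refine ContinuousAt.congr ?_ (hC z hz (not_lt.1 h1)).symm
      have hz0 : ‖z‖ ≠ 0 := norm_ne_zero_iff.2 (hne z fun h => h1 h.1)
      exact continuousAt_const.div continuous_norm.continuousAt hz0
  have hbd : ∀ z : ℂ, ‖z‖ = 1 / 2 → Φ z ≤ 2 * Real.exp (1 + 2 / δ ^ 2 * B ^ 2) := by
    intro z hzn
    have hz : z ∈ ball (0 : ℂ) 1 := by simp [hzn]; norm_num
    have hz0 : z ≠ 0 := by rintro rfl; norm_num at hzn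
    have hB0 : 0 ≤ B := by linarith [hB 0 h0b hκ0]
    have hq : 0 ≤ 2 / δ ^ 2 := by positivity
    simp only [hΦ]
    split_ifs with h1 h2
    · rw [hkey z hz0, hzn]
      have hw : 0 ≤ (W z).re := by linarith [hre z]
      have hwB := hB z hz h1.1
      have hy : ‖W z - W 0‖ / δ ≤ 1 := (div_le_one hδ).2 h1.2.le
      have hy0 : 0 ≤ ‖W z - W 0‖ / δ := by positivity
      have e1 : Real.exp (2 / δ ^ 2 * (W z).re ^ 2) ≤ Real.exp (2 / δ ^ 2 * B ^ 2) := by gcongr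
      have e2 : Real.exp (1 - (‖W z - W 0‖ / δ) ^ 2) ≤ Real.exp 1 := by
        apply Real.exp_le_exp.2; nlinarith [sq_nonneg (‖W z - W 0‖ / δ)]
      calc 1 / (1 / 2) * Real.exp (2 / δ ^ 2 * (W z).re ^ 2) *
            (‖W z - W 0‖ / δ * Real.exp (1 - (‖W z - W 0‖ / δ) ^ 2))
          ≤ 1 / (1 / 2) * Real.exp (2 / δ ^ 2 * B ^ 2) * (1 * Real.exp 1) := by gcongr
        _ = _ := by rw [Real.exp_add]; ring
    · rw [hzn]
      have hwB : max (W z).re 0 ≤ B := max_le (hB z hz h2) hB0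
      have : Real.exp (2 / δ ^ 2 * (max (W z).re 0) ^ 2) ≤ Real.exp (1 + 2 / δ ^ 2 * B ^ 2) := by
        apply Real.exp_le_exp.2
        have : 2 / δ ^ 2 * (max (W z).re 0) ^ 2 ≤ 2 / δ ^ 2 * B ^ 2 := by gcongr
        linarith
      linarith
    · rw [hzn]
      have : Real.exp (2 / δ ^ 2 * 0 ^ 2) ≤ Real.exp (1 + 2 / δ ^ 2 * B ^ 2) := by
        apply Real.exp_le_exp.2
        have : 0 ≤ 2 / δ ^ 2 * B ^ 2 := by positivity
        linarith
      linarith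
  have hmain : Φ 0 ≤ 2 * Real.exp (1 + 2 / δ ^ 2 * B ^ 2) := by
    refine max_principle_support Φ (1 / 2) _ (by norm_num) hcont ?_ hbd
    intro z hz'
    have hz := hsub (ball_subset_closedBall hz')
    have hdiffW : ∀ᶠ y in 𝓝 z, DifferentiableAt ℂ W y := by
      filter_upwards [hopen z hz] with y hy using hW.differentiableAt (hopen y hy)
    by_cases h1 : 0 < κ z
    · by_cases h2 : ‖W z - W 0‖ < δ
      · refine ⟨Hin, ?_, ?_, (hA z hz h1 h2).eq_of_nhds.symm⟩
        · filter_upwards [hopen z hz] with y hy using hHd.differentiableAt (hopen y hy)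
        · filter_upwards [hA z hz h1 h2] with y hy using hy.ge
      · have h2' := not_lt.1 h2
        have hz0 : z ≠ 0 := hne z fun h => h2 h.2
        set g := max (W z).re 0 with hg
        have hnorm : ∀ y, ‖1 / y * Complex.exp (((2 / δ ^ 2 : ℝ) : ℂ) * (2 * g * W y - g ^ 2))‖ =
            1 / ‖y‖ * Real.exp (2 / δ ^ 2 * (2 * g * (W y).re - g ^ 2)) := by
          intro y
          rw [norm_mul, Complex.norm_exp, Complex.re_ofReal_mul]
          simp [pow_two]
        refine ⟨fun y => 1 / y * Complex.exp (((2 / δ ^ 2 : ℝ) : ℂ) * (2 * g * W y - g ^ 2)),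
          ?_, ?_, ?_⟩
        · filter_upwards [hdiffW, isOpen_ne.mem_nhds hz0] with y hy hy0
          have : y ≠ 0 := hy0
          fun_prop (disch := assumption)
        · have hlarge : ∀ᶠ y in 𝓝 z, 3 / 4 * δ < ‖W y - W 0‖ :=
            (hζc z hz).eventually_const_lt (by linarith)
          filter_upwards [hBl z hz h1 h2', hlarge] with y hy hl
          rw [hnorm, hy]
          have e1 : 1 ≤ min (‖W y - W 0‖ / δ) 1 * Real.exp (1 - (min (‖W y - W 0‖ / δ) 1) ^ 2) := by
            apply bump_ge_one _ _ (min_le_right _ _)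
            apply le_min _ (by norm_num)
            rw [le_div_iff₀ hδ]; exact hl.le
          have e2 : 2 * g * (W y).re - g ^ 2 ≤ (max (W y).re 0) ^ 2 := by
            have : 0 ≤ g := le_max_right _ _
            nlinarith [sq_nonneg (max (W y).re 0 - g), le_max_left (W y).re 0]
          calc 1 / ‖y‖ * Real.exp (2 / δ ^ 2 * (2 * g * (W y).re - g ^ 2))
              ≤ 1 / ‖y‖ * Real.exp (2 / δ ^ 2 * (max (W y).re 0) ^ 2) := by gcongr
            _ ≤ _ := le_mul_of_one_le_right (by positivity) e1
        · simp only [hΦ]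
          rw [hnorm, if_neg (fun h => h2 h.2), if_pos h1]
          have : 2 * g * (W z).re - g ^ 2 = g ^ 2 := by
            rcases le_total 0 (W z).re with h | h
            · rw [hg, max_eq_left h]; ring
            · rw [hg, max_eq_right h]; ring
          rw [this]
    · have hz0 : z ≠ 0 := hne z fun h => h1 h.1
      have := hC z hz (not_lt.1 h1)
      refine ⟨fun y => 1 / y, ?_, ?_, ?_⟩
      · filter_upwards [isOpen_ne.mem_nhds hz0] with y hy0
        have : y ≠ 0 := hy0
        fun_prop (disch := assumption)
      · filter_upwards [this] with y hy
        rw [hy]; simp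
      · rw [this.eq_of_nhds]; simp
  have hval : Φ 0 = ‖deriv W 0‖ * Real.exp (1 + 2 / δ ^ 2 * w₀ ^ 2) / δ := by
    simp only [hΦ]
    rw [if_pos ⟨hκ0, by simpa using hδ⟩]
    simp only [hHin, norm_div, norm_mul, Complex.norm_exp, Complex.norm_real, dslope_same]
    rw [Real.norm_of_nonneg hδ.le, Complex.add_re, Complex.re_ofReal_mul]
    simp [pow_two]
  rw [hval, div_le_iff₀ hδ] at hmain
  have : 1 ≤ Real.exp (1 + 2 / δ ^ 2 * w₀ ^ 2) := Real.one_le_exp (by positivity)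
  calc ‖deriv W 0‖ ≤ ‖deriv W 0‖ * Real.exp (1 + 2 / δ ^ 2 * w₀ ^ 2) :=
        le_mul_of_one_le_right (norm_nonneg _) this
    _ ≤ _ := by linarith

lemma exists_holo (u : ℂ → ℝ) (hu : HarmonicOn u (ball (0 : ℂ) 1)) :
    ∃ F : ℂ → ℂ, DifferentiableOn ℂ F (ball 0 1) ∧ ∀ z ∈ ball (0 : ℂ) 1, (F z).re = u z := by
  have hcd : ∀ z ∈ ball (0 : ℂ) 1, ContDiffAt ℝ 2 u z := fun z hz =>
    hu.1.contDiffAt (isOpen_ball.mem_nhds hz)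
  have : InnerProductSpace.HarmonicOnNhd u (ball (0 : ℂ) 1) := by
    intro z hz
    refine ⟨hcd z hz, ?_⟩
    filter_upwards [isOpen_ball.mem_nhds hz] with y hy
    have h := hu.2 y hy
    have hd : DifferentiableAt ℝ (fderiv ℝ u) y :=
      ((hcd y hy).fderiv_right (m := 1) (by norm_num)).differentiableAt (by norm_num)
    rw [_root_.laplacian, fderiv_clm_apply hd (by fun_prop), fderiv_clm_apply hd (by fun_prop)] at h
    simp only [InnerProductSpace.laplacian_eq_iteratedFDeriv_complexPlane, iteratedFDeriv_two_apply]
    simpa using h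
  obtain ⟨F, h1, h2⟩ := this.exists_analyticOnNhd_ball_re_eq
  exact ⟨F, h1.differentiableOn, fun z hz => h2 hz⟩

lemma fderiv_re_norm_le (u : ℂ → ℝ) (F : ℂ → ℂ) (hF : DifferentiableOn ℂ F (ball 0 1))
    (h : ∀ z ∈ ball (0 : ℂ) 1, (F z).re = u z) :
    HasFDerivAt u (fderiv ℝ u 0) 0 ∧ ‖fderiv ℝ u 0‖ ≤ ‖deriv F 0‖ := by
  have hn : ball (0 : ℂ) 1 ∈ 𝓝 (0 : ℂ) := ball_mem_nhds _ one_pos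
  have h1 := ((hF.differentiableAt hn).hasDerivAt.hasFDerivAt.restrictScalars ℝ)
  have h2 := (Complex.reCLM.hasFDerivAt.comp (0 : ℂ) h1)
  have h3 : HasFDerivAt u _ (0 : ℂ) := h2.congr_of_eventuallyEq (by
    filter_upwards [hn] with z hz
    simp [h z hz])
  refine ⟨h3.differentiableAt.hasFDerivAt, ?_⟩
  rw [h3.fderiv]
  apply ContinuousLinearMap.opNorm_le_bound _ (norm_nonneg _)
  intro z
  simp only [ContinuousLinearMap.comp_apply, Complex.reCLM_apply, Real.norm_eq_abs]
  refine (Complex.abs_re_le_norm _).trans ?_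
  simp [mul_comm]

lemma setA_isOpen (α s t : ℝ) (hα : 0 < α) : IsOpen (setA α s t) := by
  have : setA α s t = {x : ℝ × ℝ | t * (max x.1 0) ^ α + s * (max (-x.1) 0) ^ α < x.2} := by
    ext x
    simp only [setA, mem_ofPred_eq]
    rcases lt_trichotomy x.1 0 with h | h | h
    · rw [max_eq_right h.le, max_eq_left (by linarith : 0 ≤ -x.1), Real.zero_rpow hα.ne']
      simp [h, h.ne, not_lt.2 h.le]
    · simp [h, Real.zero_rpow hα.ne']
    · rw [max_eq_left h.le, max_eq_right (by linarith : -x.1 ≤ 0), Real.zero_rpow hα.ne']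
      simp [h, h.ne', not_lt.2 h.le]
  rw [this]
  apply isOpen_lt _ continuous_snd
  have h1 : Continuous fun x : ℝ × ℝ => (max x.1 0) ^ α :=
    (continuous_fst.max continuous_const).rpow_const fun _ => Or.inr hα.le
  have h2 : Continuous fun x : ℝ × ℝ => (max (-x.1) 0) ^ α :=
    (continuous_fst.neg.max continuous_const).rpow_const fun _ => Or.inr hα.le
  exact (continuous_const.mul h1).add (continuous_const.mul h2)

lemma superlinear_bound (α t m : ℝ) (hα : 1 < α) (ht : 0 < t) :
    ∃ B : ℝ, 0 ≤ B ∧ ∀ y : ℝ, 0 ≤ y → m * y - t * y ^ α ≤ B := by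
  have htend : Tendsto (fun y : ℝ => y ^ (α - 1)) atTop atTop :=
    tendsto_rpow_atTop (by linarith)
  obtain ⟨Y, hY⟩ := (htend.eventually_ge_atTop (|m| / t)).exists_forall_of_atTop
  refine ⟨|m| * max Y 1, by positivity, fun y hy => ?_⟩
  have hp : 0 ≤ y ^ α := Real.rpow_nonneg hy α
  rcases le_total y (max Y 1) with h | h
  · have : m * y ≤ |m| * max Y 1 := mul_le_mul (le_abs_self m) h hy (abs_nonneg m)
    nlinarith
  · have hy0 : 0 < y := lt_of_lt_of_le one_pos ((le_max_right Y 1).trans h)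
    have h1 := hY y ((le_max_left Y 1).trans h)
    rw [div_le_iff₀ ht] at h1
    have h2 : y ^ α = y ^ (α - 1) * y := by
      rw [← Real.rpow_add_one hy0.ne']; ring_nf
    have h3 : m * y ≤ y ^ (α - 1) * t * y :=
      mul_le_mul_of_nonneg_right ((le_abs_self m).trans h1) hy
    have : 0 ≤ |m| * max Y 1 := by positivity
    rw [h2]
    linarith

lemma sublinear_bound (α k : ℝ) (hα : 0 < α) (hα1 : α < 1) :
    ∃ B : ℝ, 0 ≤ B ∧ ∀ y : ℝ, 0 ≤ y → k * y ^ α - y ≤ B := by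
  obtain ⟨B, hB0, hB⟩ := superlinear_bound α⁻¹ 1 k ((one_lt_inv₀ hα).2 hα1) one_pos
  refine ⟨B, hB0, fun y hy => ?_⟩
  have := hB (y ^ α) (Real.rpow_nonneg hy α)
  rwa [Real.rpow_rpow_inv hy hα.ne', one_mul] at this

lemma single_barrier (A : Set (ℝ × ℝ)) (x : ℝ × ℝ) (κ : ℝ × ℝ → ℝ) (hκ : Continuous κ)
    (p q c B : ℝ) (h0 : ∀ y ∈ A, κ y = 0 → p * y.1 + q * y.2 + c < 0)
    (hB : ∀ y ∈ A, 0 < κ y → p * y.1 + q * y.2 + c ≤ B)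
    (hκx : 0 < κ x) (hx : 0 < p * x.1 + q * x.2 + c) :
    ∃ U ∈ 𝓝 x, ∃ C : ℝ, ∀ F G : ℂ → ℂ, DifferentiableOn ℂ F (ball 0 1) →
      DifferentiableOn ℂ G (ball 0 1) →
      (∀ z ∈ ball (0 : ℂ) 1, ((F z).re, (G z).re) ∈ A) → ((F 0).re, (G 0).re) ∈ U →
      ‖p * deriv F 0 + q * deriv G 0‖ ≤ C := by
  obtain ⟨δ, hδ, hδx⟩ := exists_between hx
  refine ⟨{y | 0 < κ y ∧ δ < p * y.1 + q * y.2 + c}, ?_,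
    2 * δ * Real.exp (1 + 2 / δ ^ 2 * B ^ 2), ?_⟩
  · have hl : Continuous fun y : ℝ × ℝ => p * y.1 + q * y.2 + c := by fun_prop
    filter_upwards [hκ.continuousAt.eventually_const_lt hκx,
      hl.continuousAt.eventually_const_lt hδx] with y h1 h2
    exact ⟨h1, h2⟩
  · rintro F G hF hG hmem ⟨hU1, hU2⟩
    have hn : ball (0 : ℂ) 1 ∈ 𝓝 (0 : ℂ) := ball_mem_nhds _ one_pos
    have hFd := (hF.differentiableAt hn).hasDerivAt
    have hGd := (hG.differentiableAt hn).hasDerivAt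
    have hder : deriv (fun z => (p : ℂ) * F z + q * G z + c) 0 = p * deriv F 0 + q * deriv G 0 :=
      (((hFd.const_mul (p : ℂ)).add (hGd.const_mul (q : ℂ))).add_const (c : ℂ)).deriv
    have hre : ∀ z, ((p : ℂ) * F z + q * G z + c).re = p * (F z).re + q * (G z).re + c := by
      intro z; simp
    rw [← hder]
    refine core_bound _ (fun z => κ ((F z).re, (G z).re)) δ B hδ ?_ ?_ ?_ ?_ hU1 ?_
    · fun_prop
    · exact hκ.comp_continuousOn ((Complex.continuous_re.comp_continuousOn hF.continuousOn).prodMk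
        (Complex.continuous_re.comp_continuousOn hG.continuousOn))
    · intro z hz h; rw [hre]; exact h0 _ (hmem z hz) h
    · intro z hz h; rw [hre]; exact hB _ (hmem z hz) h
    · rw [hre]; exact hU2

lemma two_barriers (A : Set (ℝ × ℝ)) (hA : IsOpen A) (x : ℝ × ℝ) (hxA : x ∈ A)
    (p₁ q₁ p₂ q₂ : ℝ) (hdet : p₁ * q₂ - p₂ * q₁ = 1 ∨ p₁ * q₂ - p₂ * q₁ = -1)
    (h : ∀ p q : ℝ, (p = p₁ ∧ q = q₁) ∨ (p = p₂ ∧ q = q₂) →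
      ∃ U ∈ 𝓝 x, ∃ C : ℝ, ∀ F G : ℂ → ℂ, DifferentiableOn ℂ F (ball 0 1) →
      DifferentiableOn ℂ G (ball 0 1) →
      (∀ z ∈ ball (0 : ℂ) 1, ((F z).re, (G z).re) ∈ A) → ((F 0).re, (G 0).re) ∈ U →
      ‖p * deriv F 0 + q * deriv G 0‖ ≤ C) :
    ∃ U ⊆ A, U ∈ 𝓝 x ∧ ∃ M > (0 : ℝ),
      ∀ f : ℂ → ℝ × ℝ, HarmonicMapOn f (ball (0 : ℂ) 1) →
        MapsTo f (ball (0 : ℂ) 1) A → f 0 ∈ U → ‖fderiv ℝ f 0‖ < M := by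
  obtain ⟨U₁, hU₁, C₁, h₁⟩ := h p₁ q₁ (Or.inl ⟨rfl, rfl⟩)
  obtain ⟨U₂, hU₂, C₂, h₂⟩ := h p₂ q₂ (Or.inr ⟨rfl, rfl⟩)
  refine ⟨A ∩ (U₁ ∩ U₂), inter_subset_left, inter_mem (hA.mem_nhds hxA) (inter_mem hU₁ hU₂),
    (|q₂| + |p₂|) * |C₁| + (|q₁| + |p₁|) * |C₂| + 1, by positivity, ?_⟩
  rintro f ⟨hu, hv⟩ hmaps ⟨-, hf1, hf2⟩
  obtain ⟨F, hF, hFu⟩ := exists_holo _ hu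
  obtain ⟨G, hG, hGv⟩ := exists_holo _ hv
  have heq : ∀ z ∈ ball (0 : ℂ) 1, ((F z).re, (G z).re) = f z := fun z hz =>
    Prod.ext (hFu z hz) (hGv z hz)
  have h0b : (0 : ℂ) ∈ ball (0 : ℂ) 1 := by simp
  have hmem : ∀ z ∈ ball (0 : ℂ) 1, ((F z).re, (G z).re) ∈ A := fun z hz => by
    rw [heq z hz]; exact hmaps hz
  have b₁ := (h₁ F G hF hG hmem (by rw [heq 0 h0b]; exact hf1)).trans (le_abs_self C₁)
  have b₂ := (h₂ F G hF hG hmem (by rw [heq 0 h0b]; exact hf2)).trans (le_abs_self C₂)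
  obtain ⟨d1, n1⟩ := fderiv_re_norm_le _ F hF hFu
  obtain ⟨d2, n2⟩ := fderiv_re_norm_le _ G hG hGv
  have hd : HasFDerivAt f _ (0 : ℂ) := d1.prodMk d2
  set X := (p₁ : ℂ) * deriv F 0 + q₁ * deriv G 0
  set Y := (p₂ : ℂ) * deriv F 0 + q₂ * deriv G 0
  have hD : ‖((p₁ * q₂ - p₂ * q₁ : ℝ) : ℂ)‖ = 1 := by
    rcases hdet with h | h <;> rw [h] <;> simp
  have bF : ‖deriv F 0‖ ≤ |q₂| * |C₁| + |q₁| * |C₂| := by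
    calc ‖deriv F 0‖ = ‖((p₁ * q₂ - p₂ * q₁ : ℝ) : ℂ) * deriv F 0‖ := by rw [norm_mul, hD, one_mul]
      _ = ‖(q₂ : ℂ) * X - q₁ * Y‖ := by congr 1; simp only [X, Y]; push_cast; ring
      _ ≤ ‖(q₂ : ℂ) * X‖ + ‖(q₁ : ℂ) * Y‖ := norm_sub_le _ _
      _ ≤ _ := by
        rw [norm_mul, norm_mul, Complex.norm_real, Complex.norm_real, Real.norm_eq_abs,
          Real.norm_eq_abs]
        gcongr
  have bG : ‖deriv G 0‖ ≤ |p₂| * |C₁| + |p₁| * |C₂| := by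
    calc ‖deriv G 0‖ = ‖((p₁ * q₂ - p₂ * q₁ : ℝ) : ℂ) * deriv G 0‖ := by rw [norm_mul, hD, one_mul]
      _ = ‖(p₁ : ℂ) * Y - p₂ * X‖ := by congr 1; simp only [X, Y]; push_cast; ring
      _ ≤ ‖(p₁ : ℂ) * Y‖ + ‖(p₂ : ℂ) * X‖ := norm_sub_le _ _
      _ ≤ |p₁| * |C₂| + |p₂| * |C₁| := by
        rw [norm_mul, norm_mul, Complex.norm_real, Complex.norm_real, Real.norm_eq_abs,
          Real.norm_eq_abs]
        gcongr
      _ = _ := add_comm _ _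
  rw [hd.fderiv]
  have hfin : ‖(fderiv ℝ (fun z => (f z).1) 0).prod (fderiv ℝ (fun z => (f z).2) 0)‖ ≤
      (|q₂| + |p₂|) * |C₁| + (|q₁| + |p₁|) * |C₂| := by
    rw [ContinuousLinearMap.opNorm_prod, Prod.norm_def]
    have e1 : 0 ≤ |q₂| * |C₁| + |q₁| * |C₂| := by positivity
    have e2 : 0 ≤ |p₂| * |C₁| + |p₁| * |C₂| := by positivity
    apply max_le
    · simp only; linarith
    · simp only; linarith
  linarith

/-- Harmonic-map hyperbolicity criterion for `A_{α,s,t}`: every point of the base has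
a neighborhood on which derivatives at `0` of harmonic maps from the unit disk into
the base are uniformly bounded. -/
theorem baseA_harmonic_hyperbolic (α s t : ℝ) (hα : 0 < α) (hα1 : α ≠ 1)
    (hs : s < 0) (ht : 0 < t) (x : ℝ × ℝ) (hx : x ∈ setA α s t) :
    ∃ U ⊆ setA α s t, U ∈ 𝓝 x ∧ ∃ M > (0 : ℝ),
      ∀ f : ℂ → ℝ × ℝ, HarmonicMapOn f (ball (0 : ℂ) 1) →
        MapsTo f (ball (0 : ℂ) 1) (setA α s t) → f 0 ∈ U →
          ‖fderiv ℝ f 0‖ < M := by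
  have hopen := setA_isOpen α s t hα
  rcases lt_or_gt_of_ne hα1 with hlt | hgt
  · -- the sublinear case
    obtain ⟨c, hc0, hcx⟩ : ∃ c : ℝ, 0 < c ∧ x.2 < t * c ^ α := by
      have htend : Tendsto (fun y : ℝ => t * y ^ α) atTop atTop :=
        (tendsto_rpow_atTop hα).const_mul_atTop ht
      obtain ⟨c, h1, h2⟩ := ((eventually_gt_atTop 0).and (htend.eventually_gt_atTop x.2)).exists
      exact ⟨c, h1, h2⟩
    set b := t * c ^ α with hb
    have hb0 : 0 < b := by positivity
    have hlt_c : ∀ y ∈ setA α s t, y.2 ≤ b → y.1 < c := by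
      intro y hy hyb
      by_contra hcon
      have hcy := not_lt.1 hcon
      have h1 := hy.1 (hc0.trans_le hcy)
      have : t * c ^ α ≤ t * y.1 ^ α := by gcongr
      linarith
    have hbx : 0 < b - x.2 := by linarith
    set m₀ := |c - x.1| / (b - x.2) + 1 with hm₀
    have hm₀p : 0 < m₀ := by positivity
    have key : ∀ m : ℝ, m₀ ≤ m → ∃ U ∈ 𝓝 x, ∃ C : ℝ, ∀ F G : ℂ → ℂ,
        DifferentiableOn ℂ F (ball 0 1) → DifferentiableOn ℂ G (ball 0 1) →
        (∀ z ∈ ball (0 : ℂ) 1, ((F z).re, (G z).re) ∈ setA α s t) →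
        ((F 0).re, (G 0).re) ∈ U →
        ‖((1 : ℝ) : ℂ) * deriv F 0 + ((-m : ℝ) : ℂ) * deriv G 0‖ ≤ C := by
      intro m hm
      have hmp : 0 < m := hm₀p.trans_le hm
      obtain ⟨B, hB0, hB⟩ := sublinear_bound α (m * (-s)) hα hlt
      refine single_barrier (setA α s t) x (fun y => b - y.2) (by fun_prop) 1 (-m) (m * b - c)
        (m * b + B) ?_ ?_ hbx ?_
      · intro y hy h
        have := hlt_c y hy (by linarith)
        have h2 : y.2 = b := by linarith
        rw [h2]
        linarith
      · intro y hy h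
        have hyb : y.2 < b := by linarith
        have h1 := hlt_c y hy hyb.le
        rcases lt_trichotomy y.1 0 with h2 | h2 | h2
        · have h3 := hy.2.2 h2
          have h4 := hB (-y.1) (by linarith)
          nlinarith
        · have h3 := hy.2.1 h2
          nlinarith
        · have h3 := hy.1 h2
          have h4 : 0 < t * y.1 ^ α := by positivity
          nlinarith
      · have h1 : |c - x.1| < m * (b - x.2) := by
          rw [← div_lt_iff₀ hbx]; linarith
        have h2 := le_abs_self (c - x.1)
        linarith
    refine two_barriers (setA α s t) hopen x hx 1 (-m₀) 1 (-(m₀ + 1)) (Or.inr (by ring)) ?_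
    rintro p q (⟨rfl, rfl⟩ | ⟨rfl, rfl⟩)
    · exact key m₀ le_rfl
    · exact key (m₀ + 1) (by linarith)
  · -- the superlinear case
    set a := min x.1 0 - 1 with ha
    have ha0 : a < 0 := by linarith [min_le_right x.1 0]
    have hax : 1 ≤ x.1 - a := by linarith [min_le_left x.1 0]
    set φa := s * (-a) ^ α with hφ
    have hφ0 : φa < 0 := mul_neg_of_neg_of_pos hs (Real.rpow_pos_of_pos (by linarith) α)
    set m₀ := |x.2 - φa| + 1 with hm₀
    have hm₀p : 0 < m₀ := by positivity
    have key : ∀ m : ℝ, m₀ ≤ m → ∃ U ∈ 𝓝 x, ∃ C : ℝ, ∀ F G : ℂ → ℂ,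
        DifferentiableOn ℂ F (ball 0 1) → DifferentiableOn ℂ G (ball 0 1) →
        (∀ z ∈ ball (0 : ℂ) 1, ((F z).re, (G z).re) ∈ setA α s t) →
        ((F 0).re, (G 0).re) ∈ U →
        ‖(m : ℂ) * deriv F 0 + ((-1 : ℝ) : ℂ) * deriv G 0‖ ≤ C := by
      intro m hm
      have hmp : 0 < m := hm₀p.trans_le hm
      obtain ⟨B, hB0, hB⟩ := superlinear_bound α t m hgt ht
      refine single_barrier (setA α s t) x (fun y => y.1 - a) (by fun_prop) m (-1) (φa - m * a)
        (-(m * a) + B) ?_ ?_ (by linarith) ?_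
      · intro y hy h
        have hya : y.1 = a := by linarith
        have h1 := hy.2.2 (by linarith)
        rw [hya] at h1 ⊢
        linarith
      · intro y hy h
        have hya : a < y.1 := by linarith
        rcases lt_trichotomy y.1 0 with h2 | h2 | h2
        · have h3 := hy.2.2 h2
          have h4 : (-y.1) ^ α ≤ (-a) ^ α :=
            Real.rpow_le_rpow (by linarith) (by linarith) hα.le
          have h5 : φa ≤ s * (-y.1) ^ α := mul_le_mul_of_nonpos_left h4 hs.le
          nlinarith
        · have h3 := hy.2.1 h2
          rw [h2]
          linarith
        · have h3 := hy.1 h2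
          have h4 := hB y.1 h2.le
          linarith
      · have h2 := le_abs_self (x.2 - φa)
        have h3 : m ≤ m * (x.1 - a) := le_mul_of_one_le_right hmp.le hax
        linarith
    refine two_barriers (setA α s t) hopen x hx m₀ (-1) (m₀ + 1) (-1) (Or.inl (by ring)) ?_
    rintro p q (⟨rfl, rfl⟩ | ⟨rfl, rfl⟩)
    · exact key m₀ le_rfl
    · exact key (m₀ + 1) (by linarith)
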